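/- Let P̄, N^l, N^e be positive real constants, α ≥ 2, and γ > 0. Let d_c : ℕ → (0,∞) be a sequence with d_c(n) → 0 as n → ∞, and define d_e(n) = n^{1/α} · d_c(n) · (log n)^{γ/2}. Then log( (N^e/N^l) · (N^l + d_c(n)^{-α} P̄) / (N^e + n · (d_e(n)/2)^{-α} P̄) ) → ∞ as n → ∞. -/

import Mathlib

open Filter Real

/-- If the legitimate gain `A` diverges while the relative gain `s` of the eavesdroppers vanishes,
the ratio of the total received powers diverges. -/
lemma tendsto_power_ratio_atTop {ι : Type*} {l : Filter ι} {P Nl Ne : ℝ}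
    (hP : 0 < P) (hNl : 0 < Nl) (hNe : 0 < Ne) {A s : ι → ℝ}
    (hA : Tendsto A l atTop) (hs : Tendsto s l (nhds 0)) (hs0 : ∀ᶠ i in l, 0 ≤ s i) :
    Tendsto (fun i => (Nl + A i * P) / (Ne + A i * s i * P)) l atTop := by
  have hlim : Tendsto (fun i => (Ne / A i + s i * P) / (Nl / A i + P)) l (nhds 0) := by
    have h := ((hA.const_div_atTop Ne).add (hs.mul_const P)).div
      ((hA.const_div_atTop Nl).add_const P) (by simpa using hP.ne')
    simpa [Pi.div_def] using h
  have hinv : Tendsto (fun i => ((Nl + A i * P) / (Ne + A i * s i * P))⁻¹) l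
      (nhdsWithin 0 (Set.Ioi 0)) := by
    refine tendsto_nhdsWithin_iff.2 ⟨hlim.congr' ?_, ?_⟩
    · filter_upwards [hA.eventually_gt_atTop 0] with i hi
      rw [inv_div, div_add' _ _ _ hi.ne', div_add' _ _ _ hi.ne', div_div_div_cancel_right₀ hi.ne']
      ring
    · filter_upwards [hA.eventually_gt_atTop 0, hs0] with i hi hsi
      rw [Set.mem_Ioi]
      positivity
  simpa [Pi.inv_def] using hinv.inv_tendsto_nhdsGT_zero

/-- The combined gain of `x` colluders at distance `x ^ (1 / α) * d * L ^ (γ / 2) / 2`. -/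
lemma mul_rpow_colluding_distance {x d L α γ : ℝ} (hx : 0 < x) (hd : 0 < d) (hL : 0 < L)
    (hα : α ≠ 0) :
    x * (x ^ (1 / α) * d * L ^ (γ / 2) / 2) ^ (-α) =
      d ^ (-α) * (L ^ (-(γ / 2 * α)) / 2 ^ (-α)) := by
  rw [div_rpow (by positivity) (by norm_num), mul_rpow (by positivity) (by positivity),
    mul_rpow (by positivity) hd.le, ← rpow_mul hx.le, ← rpow_mul hL.le, mul_neg, mul_neg,
    one_div_mul_cancel hα, rpow_neg_one]
  field_simp

/-- **Unbounded wiretap rate against `n` colluding eavesdroppers.**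
Let `P̄, Nl, Ne > 0`, `α ≥ 2` and `γ > 0`. If `d_c n → 0` (with `d_c n > 0`)
and `d_e n = n^(1/α) * d_c n * (log n)^(γ/2)`, then
`log ((Ne/Nl) * (Nl + d_c n ^ (-α) * P̄) / (Ne + n * (d_e n / 2) ^ (-α) * P̄)) → ∞`. -/
theorem wiretap_rate_unbounded_colluding
    (P Nl Ne : ℝ) (hP : 0 < P) (hNl : 0 < Nl) (hNe : 0 < Ne)
    (α γ : ℝ) (hα : 2 ≤ α) (hγ : 0 < γ)
    (d_c : ℕ → ℝ) (hdc : ∀ n, 0 < d_c n)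
    (hdc0 : Tendsto d_c atTop (nhds 0))
    (d_e : ℕ → ℝ)
    (hde : ∀ n : ℕ, d_e n = (n : ℝ) ^ (1 / α) * d_c n * (Real.log n) ^ (γ / 2)) :
    Tendsto (fun n : ℕ =>
      Real.log ((Ne / Nl) * (Nl + d_c n ^ (-α) * P) /
        (Ne + (n : ℝ) * (d_e n / 2) ^ (-α) * P)))
      atTop atTop := by
  have hα0 : 0 < α := by linarith
  have hlog : Tendsto (fun n : ℕ => Real.log n) atTop atTop :=
    tendsto_log_atTop.comp tendsto_natCast_atTop_atTop
  have hA : Tendsto (fun n => d_c n ^ (-α)) atTop atTop :=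
    (tendsto_rpow_neg_nhdsGT_zero (neg_neg_of_pos hα0)).comp
      (tendsto_nhdsWithin_iff.2 ⟨hdc0, Eventually.of_forall hdc⟩)
  have hs : Tendsto (fun n : ℕ => Real.log n ^ (-(γ / 2 * α)) / 2 ^ (-α)) atTop (nhds 0) := by
    simpa using ((tendsto_rpow_neg_atTop (by positivity : 0 < γ / 2 * α)).comp hlog).div_const
      ((2 : ℝ) ^ (-α))
  have hs0 : ∀ᶠ n : ℕ in atTop, 0 ≤ Real.log n ^ (-(γ / 2 * α)) / 2 ^ (-α) :=
    Eventually.of_forall fun n => by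
      have := Real.log_natCast_nonneg n
      positivity
  refine tendsto_log_atTop.comp (((tendsto_power_ratio_atTop hP hNl hNe hA hs hs0).const_mul_atTop
    (div_pos hNe hNl)).congr' ?_)
  filter_upwards [eventually_gt_atTop 0, hlog.eventually_gt_atTop 0] with n hn hL
  rw [hde, mul_rpow_colluding_distance (Nat.cast_pos.2 hn) (hdc n) hL hα0.ne', mul_div_assoc]
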